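/- Define the filtration g^0 = 0, g^1 = span{p_1,...,p_n}, g^m = g^1 + Σ_{i+j≤m} [g^i, g^j] for m > 1 on g(n). Then for every m ≥ 1, dim(g^m / g^{m−1}) ≤ n if m is odd, and dim(g^m / g^{m−1}) ≤ n(n−1)/2 if m is even. -/

import Mathlib

noncomputable section

def gRel (n : ℕ) (r : Fin n → ℂ) : Set (FreeLieAlgebra ℂ (Fin n)) :=
  {x | ∃ i j k : Fin n, i ≠ k ∧ j ≠ k ∧
        x = ⁅FreeLieAlgebra.of ℂ i, ⁅FreeLieAlgebra.of ℂ i, FreeLieAlgebra.of ℂ k⁆⁆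
            - ⁅FreeLieAlgebra.of ℂ j, ⁅FreeLieAlgebra.of ℂ j, FreeLieAlgebra.of ℂ k⁆⁆
            - (r j - r i) • FreeLieAlgebra.of ℂ k} ∪
  {x | ∃ i j k : Fin n, i ≠ j ∧ i ≠ k ∧ j ≠ k ∧
        x = ⁅FreeLieAlgebra.of ℂ i, ⁅FreeLieAlgebra.of ℂ j, FreeLieAlgebra.of ℂ k⁆⁆}

def gIdeal (n : ℕ) (r : Fin n → ℂ) : LieIdeal ℂ (FreeLieAlgebra ℂ (Fin n)) :=
  LieSubmodule.lieSpan ℂ (FreeLieAlgebra ℂ (Fin n)) (gRel n r)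

abbrev gLL (n : ℕ) (r : Fin n → ℂ) : Type := FreeLieAlgebra ℂ (Fin n) ⧸ gIdeal n r

def pgen (n : ℕ) (r : Fin n → ℂ) (i : Fin n) : gLL n r :=
  LieSubmodule.Quotient.mk (N := gIdeal n r) (FreeLieAlgebra.of ℂ i)


end

section Tower

variable {ι V L : Type*} [AddCommGroup V] [Module ℂ V] [LieRing L]
  {P : ℕ → ι → L} {R : ℕ → ι → ι → L} {m : ℕ}

/-- The brackets of two odd elements whose indices add up to `m`. -/
def EvenTable (P : ℕ → ι → L) (R : ℕ → ι → ι → L) (m : ℕ) : Prop :=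
  ∀ x y, x + y = m → ∀ i j, ⁅P x i, P y j⁆ = R m i j

theorem EvenTable.skew (h : EvenTable P R m) (i j : ι) : R m i j = -R m j i := by
  rw [← h m 0 (by simp) i j, ← h 0 m (by simp) j i, lie_skew]

variable [LieAlgebra ℂ L]

/-- Families `P k i` and `R k i j` built by iterated brackets from elements `P 0 i` obeying the
defining relations. In the loop algebra model they are `λ ^ k • λᵢ • (eᵢ ∧ e)` and
`λ ^ k • λᵢ • λⱼ • (eᵢ ∧ eⱼ)`, where `λ = λᵢ ^ 2 + rᵢ`. -/
structure IsTower (r : ι → ℂ) (P : ℕ → ι → L) (R : ℕ → ι → ι → L) : Prop where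
  even_eq : ∀ k i j, R k i j = ⁅P k i, P 0 j⁆
  odd_eq : ∀ k i, ∃ j, i ≠ j ∧ P (k + 1) i = ⁅R k i j, P 0 j⁆ + r j • P k i
  rel_sq : ∀ i j k, i ≠ k → j ≠ k →
    ⁅P 0 i, ⁅P 0 i, P 0 k⁆⁆ + r i • P 0 k = ⁅P 0 j, ⁅P 0 j, P 0 k⁆⁆ + r j • P 0 k
  rel_distinct : ∀ i j k, i ≠ j → i ≠ k → j ≠ k → ⁅P 0 i, ⁅P 0 j, P 0 k⁆⁆ = 0

/-- The brackets of an even and an odd element whose indices add up to `m`. -/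
structure OddTable (r : ι → ℂ) (P : ℕ → ι → L) (R : ℕ → ι → ι → L) (m : ℕ) : Prop where
  shared : ∀ x y, x + y = m → ∀ i j, i ≠ j →
    ⁅R x i j, P y j⁆ = P (m + 1) i - r j • P m i
  distinct : ∀ x y, x + y = m → ∀ i j k, i ≠ j → i ≠ k → j ≠ k → ⁅R x i j, P y k⁆ = 0

variable {r : ι → ℂ}

theorem eq_zero_of_self_eq_neg {v : V} (h : v = -v) : v = 0 := by
  have : (2 : ℂ) • v = 0 := by linear_combination (norm := module) h
  exact (smul_eq_zero.mp this).resolve_left two_ne_zero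

theorem EvenTable.self (h : EvenTable P R m) (i : ι) : R m i i = 0 :=
  eq_zero_of_self_eq_neg (h.skew i i)

theorem OddTable.shared_left (h : OddTable r P R m) {x y : ℕ} (he : EvenTable P R x)
    (hxy : x + y = m) {i j : ι} (hij : i ≠ j) :
    ⁅R x i j, P y i⁆ = -(P (m + 1) j - r i • P m j) := by
  rw [he.skew, neg_lie, h.shared x y hxy j i hij.symm]

theorem IsTower.lie_even_even_shared (hT : IsTower r P R) {x y : ℕ} (hx : OddTable r P R x)
    (hxy : OddTable r P R (x + y)) {i j k : ι} (hij : i ≠ j) (hik : i ≠ k) (hjk : j ≠ k) :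
    ⁅R x i j, R y j k⁆ = R (x + y + 1) i k - r j • R (x + y) i k := by
  rw [hT.even_eq y j k, leibniz_lie, hxy.shared x y rfl i j hij,
    hx.distinct x 0 rfl i j k hij hik hjk, lie_zero, add_zero, sub_lie, smul_lie,
    ← hT.even_eq, ← hT.even_eq]

theorem eq_zero_of_diag_relations (hι : ∀ i j : ι, ∃ k, i ≠ k ∧ j ≠ k) {D : ι → ℕ → V}
    (hskew : ∀ i u v, u + v = m + 1 → D i u = -D i v)
    (hD : ∀ i j, i ≠ j → ∀ a b c d, a + b + c + d = m → D i a + D i b + D j c + D j d = 0)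
    (i : ι) {u : ℕ} (hu : u ≤ m + 1) : D i u = 0 := by
  have h3 : ∀ i j, i ≠ j → D i 1 = D i 0 + (2 : ℂ) • D j 0 := by
    intro i j hij
    have h := hD i j hij 0 m 0 0 (by omega)
    rw [hskew i m 1 rfl] at h
    linear_combination (norm := module) -h
  have hc : ∀ i j, D i 0 = D j 0 := by
    intro i j
    obtain ⟨k, hik, hjk⟩ := hι i j
    have h := (h3 k i hik.symm).symm.trans (h3 k j hjk.symm)
    linear_combination (norm := module) (1 / 2 : ℂ) • h
  have h3' : ∀ i, D i 1 = (3 : ℂ) • D i 0 := by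
    intro i
    obtain ⟨j, hij, -⟩ := hι i i
    rw [h3 i j hij, hc j i]
    module
  have hlin : ∀ u, u ≤ m → D i u = (2 * u + 1 : ℂ) • D i 0 := by
    intro u
    induction u with
    | zero => intro _; simp
    | succ u ih =>
      intro hu
      obtain ⟨j, hij, -⟩ := hι i i
      have e1 := hD i j hij (u + 1) (m - u - 1) 0 0 (by omega)
      have e2 := hD i j hij u (m - u - 1) 1 0 (by omega)
      rw [h3' j, ih (by omega), hc j i] at e2
      rw [hc j i] at e1
      push_cast
      linear_combination (norm := module) e1 - e2
  have h0 : D i 0 = 0 := by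
    have h : (2 * m + 4 : ℂ) • D i 0 = 0 := by
      have e := hskew i m 1 rfl
      rw [hlin m le_rfl, h3'] at e
      linear_combination (norm := module) e
    refine (smul_eq_zero.mp h).resolve_left ?_
    exact_mod_cast (by omega : 2 * m + 4 ≠ 0)
  rcases Nat.lt_or_ge m u with h | h
  · rw [hskew i u 0 (by omega), h0, neg_zero]
  · rw [hlin u h, h0, smul_zero]

theorem IsTower.lie_odd_odd_of_ne (hT : IsTower r P R) (hι : ∀ i j : ι, ∃ k, i ≠ k ∧ j ≠ k)
    (hE : ∀ k ≤ m, EvenTable P R k) (hO : ∀ k ≤ m, OddTable r P R k)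
    {x y : ℕ} (hxy : x + y = m + 1) {i j : ι} (hij : i ≠ j) : ⁅P x i, P y j⁆ = R (m + 1) i j := by
  have step : ∀ x z, x + z = m → ∀ i j, i ≠ j → ⁅P (x + 1) i, P z j⁆ = R (m + 1) i j := by
    intro x z hxz i j hij
    have h := leibniz_lie (R x i j) (P 0 j) (P z j)
    rw [hE z (by omega) 0 z (by omega), (hE z (by omega)).self, lie_zero,
      (hO x (by omega)).shared x 0 rfl i j hij, (hO m le_rfl).shared x z hxz i j hij,
      sub_lie, smul_lie, lie_sub, lie_smul, hE m le_rfl x z hxz, hE m le_rfl 0 m (by omega),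
      (hE m le_rfl).skew j i, ← lie_skew (P 0 j), ← hT.even_eq] at h
    linear_combination (norm := module) -h
  have skew : R (m + 1) i j = -R (m + 1) j i := by
    obtain ⟨k, hik, hjk⟩ := hι i j
    have h1 := hT.lie_even_even_shared (x := m) (y := 0) (hO m le_rfl) (hO m le_rfl)
      hik hij hjk.symm
    have h2 := lie_lie (P 0 i) (P m k) (R 0 k j)
    rw [hE m le_rfl 0 m (by omega), h1, ← lie_skew (P m k), ← lie_skew (P 0 i) (R 0 k j),
      (hO m le_rfl).shared_left (hE 0 (by omega)) (by omega) hjk.symm,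
      (hO 0 (by omega)).distinct 0 0 rfl k j i hjk.symm hik.symm hij.symm, neg_neg, lie_sub,
      lie_smul, hE m le_rfl 0 m (by omega), ← lie_skew, ← hT.even_eq] at h2
    simp only [add_zero, neg_zero, lie_zero, sub_zero] at h2
    linear_combination (norm := module) h2
  rcases x with _ | x
  · obtain rfl : y = m + 1 := by omega
    rw [← lie_skew, ← hT.even_eq, skew]
  · exact step x y (by omega) i j hij

theorem IsTower.evenTable_succ (hT : IsTower r P R) (hι : ∀ i j : ι, ∃ k, i ≠ k ∧ j ≠ k)
    (hE : ∀ k ≤ m, EvenTable P R k) (hO : ∀ k ≤ m, OddTable r P R k) :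
    EvenTable P R (m + 1) := by
  have key : ∀ i j, i ≠ j → ∀ x y z, x + y + z = m →
      ⁅P (x + y + 1) i, P z i⁆ + ⁅P (x + z + 1) j, P y j⁆ + ⁅R x i j, R (y + z) i j⁆ = 0 := by
    intro i j hij x y z hxyz
    have h := leibniz_lie (R x i j) (P y j) (P z i)
    rw [hE (y + z) (by omega) y z rfl, (hE (y + z) (by omega)).skew, lie_neg,
      (hO (x + y) (by omega)).shared x y rfl i j hij,
      (hO (x + z) (by omega)).shared_left (hE x (by omega)) rfl hij, sub_lie, smul_lie, lie_neg,
      lie_sub, lie_smul, hE m le_rfl (x + y) z hxyz, hE m le_rfl y (x + z) (by omega),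
      (hE m le_rfl).self, (hE m le_rfl).self, ← lie_skew (P y j)] at h
    simp only [smul_zero, sub_zero, neg_neg] at h
    linear_combination (norm := module) -h
  have diag := eq_zero_of_diag_relations (m := m) (D := fun i u => ⁅P (m + 1 - u) i, P u i⁆) hι
    (by
      intro i u v huv
      obtain rfl : u = m + 1 - v := by omega
      rw [← lie_skew, show m + 1 - (m + 1 - v) = v by omega])
    (by
      intro i j hij a b c d habcd
      have h1 := key i j hij (b + d) c a (by omega)
      have h2 := key i j hij (a + c) d b (by omega)
      rw [add_comm c a] at h1
      rw [show b + d + c + 1 = m + 1 - a by omega, show b + d + a + 1 = m + 1 - c by omega] at h1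
      rw [show a + c + d + 1 = m + 1 - b by omega, show a + c + b + 1 = m + 1 - d by omega] at h2
      rw [← lie_skew (R (a + c) i j), add_comm d b] at h2
      linear_combination (norm := module) h1 + h2)
  intro x y hxy i j
  rcases eq_or_ne i j with rfl | hij
  · have h0 := diag i (u := 0) (by omega)
    have h := diag i (u := y) (by omega)
    simp only [show m + 1 - y = x by omega] at h
    rw [h, hT.even_eq]
    exact h0.symm
  · exact hT.lie_odd_odd_of_ne hι hE hO hxy hij

theorem eq_zero_of_triple_relations (hm : 0 < m) {e : ι → ι → ι → ℕ → V}
    (hcyc : ∀ i j k, i ≠ j → i ≠ k → j ≠ k → e i j k 0 + e j k i m + e k i j m = 0)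
    (hadd : ∀ i j k, i ≠ j → i ≠ k → j ≠ k → ∀ x y, x + y + 1 ≤ m →
      e k i j (x + y + 1) = e i j k x + e j k i y)
    {i j k : ι} (hij : i ≠ j) (hik : i ≠ k) (hjk : j ≠ k) {x : ℕ} (hx : x ≤ m) :
    e i j k x = 0 := by
  have rot : ∀ i j k, i ≠ j → i ≠ k → j ≠ k → e j k i 0 = e i j k 0 := by
    intro i j k hij hik hjk
    have h1 := hcyc i j k hij hik hjk
    have h2 := hcyc j k i hjk hij.symm hik.symm
    have h3 := hadd j k i hjk hij.symm hik.symm 0 (m - 1) (by omega)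
    have h4 := hadd k i j hik.symm hjk.symm hij (m - 1) 0 (by omega)
    simp only [show 0 + (m - 1) + 1 = m by omega, show m - 1 + 0 + 1 = m by omega] at h3 h4
    linear_combination (norm := module) (1 / 2 : ℂ) • (h2 - h1 - h3 + h4)
  have lin : ∀ x, x ≤ m → ∀ i j k, i ≠ j → i ≠ k → j ≠ k →
      e i j k x = (x + 1 : ℂ) • e i j k 0 := by
    intro x
    induction x with
    | zero => intros; simp
    | succ x ih =>
      intro hx i j k hij hik hjk
      have h := hadd j k i hjk hij.symm hik.symm x 0 (by omega)
      rw [add_zero, ih (by omega) j k i hjk hij.symm hik.symm,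
        rot j k i hjk hij.symm hik.symm, rot i j k hij hik hjk] at h
      rw [h]
      push_cast
      module
  have h0 : e i j k 0 = 0 := by
    have h : (2 * m + 3 : ℂ) • e i j k 0 = 0 := by
      have h := hcyc i j k hij hik hjk
      rw [lin m le_rfl j k i hjk hij.symm hik.symm, lin m le_rfl k i j hik.symm hjk.symm hij,
        rot j k i hjk hij.symm hik.symm, rot i j k hij hik hjk] at h
      linear_combination (norm := module) h
    refine (smul_eq_zero.mp h).resolve_left ?_
    exact_mod_cast (by omega : 2 * m + 3 ≠ 0)
  rw [lin x hx i j k hij hik hjk, h0, smul_zero]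

theorem IsTower.lie_even_odd_distinct (hT : IsTower r P R)
    (hE : ∀ k ≤ m + 1, EvenTable P R k) (hO : ∀ k ≤ m, OddTable r P R k)
    {x y : ℕ} (hxy : x + y = m + 1) {i j k : ι} (hij : i ≠ j) (hik : i ≠ k) (hjk : j ≠ k) :
    ⁅R x i j, P y k⁆ = 0 := by
  have key := eq_zero_of_triple_relations (m := m + 1) m.succ_pos
    (e := fun i j k x => ⁅R x i j, P (m + 1 - x) k⁆)
    (by
      intro i j k _ _ _
      simp only [Nat.sub_self, Nat.sub_zero]
      have h := lie_lie (P 0 i) (P 0 j) (P (m + 1) k)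
      rw [hE 0 (by omega) 0 0 rfl, hE (m + 1) le_rfl 0 (m + 1) (by omega),
        hE (m + 1) le_rfl 0 (m + 1) (by omega), ← lie_skew (P 0 i), ← lie_skew (P 0 j),
        (hE (m + 1) le_rfl).skew i k, neg_lie] at h
      rw [h]
      abel)
    (by
      intro i j k hij hik hjk x y h
      obtain ⟨z, rfl⟩ : ∃ z, m = x + y + z := ⟨m - x - y, by omega⟩
      have h := lie_lie (R x i j) (R y j k) (P z j)
      have h1 := (hO (x + y + z) le_rfl).distinct (x + y) z rfl i k j hik hij hjk.symm
      rw [hT.lie_even_even_shared (hO x (by omega)) (hO (x + y) (by omega)) hij hik hjk,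
        (hO (x + z) (by omega)).shared x z rfl i j hij,
        (hO (y + z) (by omega)).shared_left (hE y (by omega)) rfl hjk, sub_lie, smul_lie, h1,
        lie_neg, lie_sub, lie_sub, lie_smul, lie_smul,
        (hO (x + y + z) le_rfl).distinct x (y + z) (by omega) i j k hij hik hjk,
        (hO (x + y + z) le_rfl).distinct y (x + z) (by omega) j k i hjk hij.symm hik.symm,
        (hE (x + y + 1) (by omega)).skew, neg_lie] at h
      simp only [smul_zero, sub_zero] at h
      rw [show x + y + z + 1 - (x + y + 1) = z by omega,
        show x + y + z + 1 - x = y + z + 1 by omega, show x + y + z + 1 - y = x + z + 1 by omega]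
      linear_combination (norm := module) -h)
    hij hik hjk (x := x) (by omega)
  simpa only [show m + 1 - x = y by omega] using key

theorem IsTower.oddTable_succ (hT : IsTower r P R)
    (hE : ∀ k ≤ m + 1, EvenTable P R k) (hO : ∀ k ≤ m, OddTable r P R k) :
    OddTable r P R (m + 1) := by
  refine ⟨?_, fun x y hxy i j k => hT.lie_even_odd_distinct hE hO hxy⟩
  intro x y hxy i j hij
  have base : ∀ x y, x + y = m + 1 → ∀ j, ⁅R x i j, P y j⁆ = ⁅R (m + 1) i j, P 0 j⁆ := by
    intro x y hxy j
    rw [hT.even_eq x i j, lie_lie, hE y (by omega) 0 y (by omega), (hE y (by omega)).self,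
      hE (m + 1) le_rfl x y hxy, lie_zero, zero_sub, lie_skew]
  have indep : ∀ k, i ≠ k → j ≠ k → ⁅R (m + 1) i j, P 0 j⁆ + r j • P (m + 1) i =
      ⁅R (m + 1) i k, P 0 k⁆ + r k • P (m + 1) i := by
    intro k hik hjk
    have h := lie_lie (R m i j) (R 0 j k) (P 0 k)
    rw [hT.lie_even_even_shared (hO m le_rfl) (by simpa using hO m le_rfl) hij hik hjk,
      (hO 0 (by omega)).shared 0 0 rfl j k hjk,
      (hO m le_rfl).distinct m 0 rfl i j k hij hik hjk, lie_zero, sub_zero, sub_lie, smul_lie,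
      add_zero, (hO m le_rfl).shared m 0 rfl i k hik, lie_sub, lie_smul,
      (hO m le_rfl).shared m 0 rfl i j hij] at h
    have h1 : ⁅R m i j, P (0 + 1) j⁆ = ⁅R (m + 1) i j, P 0 j⁆ := base m 1 rfl j
    rw [h1] at h
    linear_combination (norm := module) -h
  obtain ⟨k, hik, hk⟩ := hT.odd_eq (m + 1) i
  rw [base x y hxy, hk]
  rcases eq_or_ne j k with rfl | hjk
  · abel
  · rw [← indep k hik hjk]
    abel

theorem IsTower.evenTable_zero (hT : IsTower r P R) : EvenTable P R 0 := by
  intro x y hxy i j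
  obtain ⟨rfl, rfl⟩ : x = 0 ∧ y = 0 := by omega
  exact (hT.even_eq 0 i j).symm

theorem IsTower.oddTable_zero (hT : IsTower r P R) : OddTable r P R 0 := by
  constructor
  · intro x y hxy i j hij
    obtain ⟨rfl, rfl⟩ : x = 0 ∧ y = 0 := by omega
    have key : ∀ j, ⁅R 0 i j, P 0 j⁆ = ⁅P 0 j, ⁅P 0 j, P 0 i⁆⁆ := fun j => by
      rw [hT.even_eq, ← lie_skew, ← lie_neg, lie_skew]
    obtain ⟨k, hik, hk⟩ := hT.odd_eq 0 i
    rw [hk, key, key, ← hT.rel_sq j k i hij.symm hik.symm]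
    abel
  · intro x y hxy i j k hij hik hjk
    obtain ⟨rfl, rfl⟩ : x = 0 ∧ y = 0 := by omega
    rw [hT.even_eq, ← lie_skew, hT.rel_distinct k i j hik.symm hjk.symm hij, neg_zero]

theorem IsTower.tables (hT : IsTower r P R) (hι : ∀ i j : ι, ∃ k, i ≠ k ∧ j ≠ k) (m : ℕ) :
    EvenTable P R m ∧ OddTable r P R m := by
  induction m using Nat.strong_induction_on with
  | _ m ih =>
    rcases m with _ | m
    · exact ⟨hT.evenTable_zero, hT.oddTable_zero⟩
    · have hO : ∀ k ≤ m, OddTable r P R k := fun k hk => (ih k (by omega)).2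
      have hE : EvenTable P R (m + 1) :=
        hT.evenTable_succ hι (fun k hk => (ih k (by omega)).1) hO
      refine ⟨hE, hT.oddTable_succ (fun k hk => ?_) hO⟩
      rcases Nat.lt_or_ge k (m + 1) with h | h
      · exact (ih k h).1
      · obtain rfl : k = m + 1 := by omega
        exact hE

/-- The span of the tower elements of degree at most `m`, where `P k i` has degree `2 * k + 1` and
`R k i j` has degree `2 * k + 2`. -/
def towerSpan (P : ℕ → ι → L) (R : ℕ → ι → ι → L) (m : ℕ) : Submodule ℂ L :=
  Submodule.span ℂ ({v | ∃ k i, 2 * k + 1 ≤ m ∧ P k i = v} ∪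
    {v | ∃ k i j, 2 * k + 2 ≤ m ∧ R k i j = v})

theorem odd_mem_towerSpan {k : ℕ} (h : 2 * k + 1 ≤ m) (i : ι) : P k i ∈ towerSpan P R m :=
  Submodule.subset_span (Or.inl ⟨k, i, h, rfl⟩)

theorem even_mem_towerSpan {k : ℕ} (h : 2 * k + 2 ≤ m) (i j : ι) : R k i j ∈ towerSpan P R m :=
  Submodule.subset_span (Or.inr ⟨k, i, j, h, rfl⟩)

theorem towerSpan_le {W : Submodule ℂ L} (hP : ∀ k i, 2 * k + 1 ≤ m → P k i ∈ W)
    (hR : ∀ k i j, 2 * k + 2 ≤ m → R k i j ∈ W) : towerSpan P R m ≤ W := by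
  refine Submodule.span_le.mpr ?_
  rintro v (⟨k, i, h, rfl⟩ | ⟨k, i, j, h, rfl⟩)
  exacts [hP k i h, hR k i j h]

theorem towerSpan_mono {m' : ℕ} (h : m ≤ m') : towerSpan P R m ≤ towerSpan P R m' :=
  towerSpan_le (fun _ i hk => odd_mem_towerSpan (hk.trans h) i)
    (fun _ i j hk => even_mem_towerSpan (hk.trans h) i j)

theorem lie_odd_mem_towerSpan (hE : ∀ k, EvenTable P R k) (hO : ∀ k, OddTable r P R k)
    {y : ℕ} {v : L} (hv : v ∈ towerSpan P R m) (k : ι) :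
    ⁅v, P y k⁆ ∈ towerSpan P R (m + (2 * y + 1)) := by
  induction hv using Submodule.span_induction with
  | zero => simp
  | add v w _ _ hv hw => rw [add_lie]; exact add_mem hv hw
  | smul c v _ hv => rw [smul_lie]; exact Submodule.smul_mem _ c hv
  | mem v hv =>
    rcases hv with ⟨x, i, h, rfl⟩ | ⟨x, i, j, h, rfl⟩
    · rw [hE _ x y rfl]
      exact even_mem_towerSpan (by omega) i k
    · have hmem : ∀ i c, P (x + y + 1) i - c • P (x + y) i ∈
          towerSpan P R (m + (2 * y + 1)) := fun i c =>
        sub_mem (odd_mem_towerSpan (by omega) i)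
          (Submodule.smul_mem _ c (odd_mem_towerSpan (by omega) i))
      rcases eq_or_ne i j with rfl | hij
      · simp [(hE x).self]
      rcases eq_or_ne j k with rfl | hjk
      · rw [(hO (x + y)).shared x y rfl i j hij]
        exact hmem i _
      rcases eq_or_ne i k with rfl | hik
      · rw [(hO (x + y)).shared_left (hE x) rfl hij]
        exact neg_mem (hmem j _)
      · simp [(hO (x + y)).distinct x y rfl i j k hij hik hjk]

theorem IsTower.lie_mem_towerSpan (hT : IsTower r P R) (hE : ∀ k, EvenTable P R k)
    (hO : ∀ k, OddTable r P R k) {m' : ℕ} {v w : L} (hv : v ∈ towerSpan P R m)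
    (hw : w ∈ towerSpan P R m') : ⁅v, w⁆ ∈ towerSpan P R (m + m') := by
  induction hw using Submodule.span_induction with
  | zero => simp
  | add u w _ _ hu hw => rw [lie_add]; exact add_mem hu hw
  | smul c w _ hw => rw [lie_smul]; exact Submodule.smul_mem _ c hw
  | mem w hw =>
    rcases hw with ⟨y, k, h, rfl⟩ | ⟨y, k, l, h, rfl⟩
    · exact towerSpan_mono (by omega) (lie_odd_mem_towerSpan hE hO hv k)
    · have h1 := lie_odd_mem_towerSpan hE hO (y := 0) (lie_odd_mem_towerSpan hE hO (y := y) hv k) l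
      have h2 := lie_odd_mem_towerSpan hE hO (y := y) (lie_odd_mem_towerSpan hE hO (y := 0) hv l) k
      rw [hT.even_eq, leibniz_lie, ← lie_skew (P y k)]
      exact add_mem (towerSpan_mono (by omega) h1) (neg_mem (towerSpan_mono (by omega) h2))

theorem IsTower.filtration_eq_towerSpan (hT : IsTower r P R) (hE : ∀ k, EvenTable P R k)
    (hO : ∀ k, OddTable r P R k) {F : ℕ → Submodule ℂ L} (h0 : F 0 = ⊥)
    (h1 : F 1 = Submodule.span ℂ (Set.range (P 0)))
    (hF : ∀ m, 2 ≤ m → F m = F 1 ⊔ Submodule.span ℂ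
      {z | ∃ (i j : ℕ) (x y : L), i + j ≤ m ∧ x ∈ F i ∧ y ∈ F j ∧ z = ⁅x, y⁆}) (m : ℕ) :
    F m = towerSpan P R m := by
  induction m using Nat.strong_induction_on with
  | _ m ih =>
    rcases Nat.lt_or_ge m 2 with hm | hm
    · interval_cases m
      · rw [h0, eq_comm, eq_bot_iff]
        exact towerSpan_le (fun k i h => absurd h (by omega)) (fun k i j h => absurd h (by omega))
      · rw [h1]
        refine le_antisymm (Submodule.span_le.mpr ?_)
          (towerSpan_le (fun k i h => ?_) (fun k i j h => absurd h (by omega)))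
        · rintro _ ⟨i, rfl⟩
          exact odd_mem_towerSpan (k := 0) (by omega) i
        · obtain rfl : k = 0 := by omega
          exact Submodule.subset_span ⟨i, rfl⟩
    · have hlie : ∀ {i j x y}, i + j ≤ m → x ∈ F i → y ∈ F j → ⁅x, y⁆ ∈ F m := by
        intro i j x y hij hx hy
        rw [hF m hm]
        exact Submodule.mem_sup_right (Submodule.subset_span ⟨i, j, x, y, hij, hx, hy, rfl⟩)
      have hgen : ∀ i, P 0 i ∈ F 1 := fun i => h1 ▸ Submodule.subset_span ⟨i, rfl⟩
      apply le_antisymm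
      · rw [hF m hm]
        refine sup_le (ih 1 (by omega) ▸ towerSpan_mono (by omega)) (Submodule.span_le.mpr ?_)
        rintro _ ⟨i, j, x, y, hij, hx, hy, rfl⟩
        rcases Nat.eq_zero_or_pos i with rfl | hi
        · rw [h0, Submodule.mem_bot] at hx
          simp [hx]
        rcases Nat.eq_zero_or_pos j with rfl | hj
        · rw [h0, Submodule.mem_bot] at hy
          simp [hy]
        rw [ih i (by omega)] at hx
        rw [ih j (by omega)] at hy
        exact towerSpan_mono hij (hT.lie_mem_towerSpan hE hO hx hy)
      · refine towerSpan_le (fun k => ?_) (fun k i j hk => ?_)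
        · induction k with
          | zero =>
            intro i _
            rw [hF m hm]
            exact Submodule.mem_sup_left (hgen i)
          | succ k ihk =>
            intro i hk
            obtain ⟨j, -, hj⟩ := hT.odd_eq k i
            rw [hj]
            refine add_mem (hlie (i := 2 * k + 2) (j := 1) (by omega) ?_ (hgen j))
              (Submodule.smul_mem _ _ (ihk i (by omega)))
            rw [ih _ (by omega)]
            exact even_mem_towerSpan le_rfl i j
        · rw [hT.even_eq]
          refine hlie (i := 2 * k + 1) (j := 1) (by omega) ?_ (hgen j)
          rw [ih _ (by omega)]
          exact odd_mem_towerSpan le_rfl i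

theorem towerSpan_odd (k : ℕ) : towerSpan P R (2 * k + 1) =
    towerSpan P R (2 * k) ⊔ Submodule.span ℂ (Set.range (P k)) := by
  apply le_antisymm
  · refine towerSpan_le (fun l i hl => ?_) (fun l i j hl => ?_)
    · rcases eq_or_ne l k with rfl | hlk
      · exact Submodule.mem_sup_right (Submodule.subset_span ⟨i, rfl⟩)
      · exact Submodule.mem_sup_left (odd_mem_towerSpan (by omega) i)
    · exact Submodule.mem_sup_left (even_mem_towerSpan (by omega) i j)
  · refine sup_le (towerSpan_mono (by omega)) (Submodule.span_le.mpr ?_)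
    rintro _ ⟨i, rfl⟩
    exact odd_mem_towerSpan le_rfl i

theorem towerSpan_even {n : ℕ} {P : ℕ → Fin n → L} {R : ℕ → Fin n → Fin n → L} {k : ℕ}
    (hE : EvenTable P R k) : towerSpan P R (2 * k + 2) = towerSpan P R (2 * k + 1) ⊔
      Submodule.span ℂ (Set.range fun q : Σ i : Fin n, Fin i =>
        R k q.1 (q.2.castLT (q.2.isLt.trans q.1.isLt))) := by
  apply le_antisymm
  · refine towerSpan_le (fun l i hl => ?_) (fun l i j hl => ?_)
    · exact Submodule.mem_sup_left (odd_mem_towerSpan (by omega) i)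
    · rcases eq_or_ne l k with rfl | hlk
      · apply Submodule.mem_sup_right
        rcases lt_trichotomy i j with hij | rfl | hij
        · rw [hE.skew]
          exact neg_mem (Submodule.subset_span ⟨⟨j, ⟨i, hij⟩⟩, rfl⟩)
        · simp [hE.self]
        · exact Submodule.subset_span ⟨⟨i, ⟨j, hij⟩⟩, rfl⟩
      · exact Submodule.mem_sup_left (even_mem_towerSpan (by omega) i j)
  · refine sup_le (towerSpan_mono (by omega)) (Submodule.span_le.mpr ?_)
    rintro _ ⟨q, rfl⟩
    exact even_mem_towerSpan le_rfl _ _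

theorem rank_quotient_comap_sup_span_le {κ : Type} [Fintype κ] {U W : Submodule ℂ V} (f : κ → V)
    (h : W = U ⊔ Submodule.span ℂ (Set.range f)) :
    Module.rank ℂ (↥W ⧸ U.comap W.subtype) ≤ (Fintype.card κ : Cardinal) := by
  rw [sup_comm] at h
  subst h
  rw [← (LinearMap.quotientInfEquivSupQuotient _ U).rank_eq]
  refine (rank_quotient_le _).trans ((rank_span_le _).trans ?_)
  simpa using Cardinal.mk_range_le_lift (f := f)

/-- The odd elements `λ ^ k • pᵢ`, raised in degree by bracketing twice with `p (s i)`. -/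
def oddTower (r : ι → ℂ) (p : ι → L) (s : ι → ι) : ℕ → ι → L
  | 0, i => p i
  | k + 1, i => ⁅⁅oddTower r p s k i, p (s i)⁆, p (s i)⁆ + r (s i) • oddTower r p s k i

theorem isTower_oddTower {p : ι → L} {s : ι → ι} (hs : ∀ i, i ≠ s i)
    (rel_sq : ∀ i j k, i ≠ k → j ≠ k →
      ⁅p i, ⁅p i, p k⁆⁆ + r i • p k = ⁅p j, ⁅p j, p k⁆⁆ + r j • p k)
    (rel_distinct : ∀ i j k, i ≠ j → i ≠ k → j ≠ k → ⁅p i, ⁅p j, p k⁆⁆ = 0) :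
    IsTower r (oddTower r p s) (fun k i j => ⁅oddTower r p s k i, p j⁆) where
  even_eq _ _ _ := rfl
  odd_eq _ i := ⟨s i, hs i, rfl⟩
  rel_sq := rel_sq
  rel_distinct := rel_distinct

end Tower

theorem pgen_rel_sq {n : ℕ} {r : Fin n → ℂ} {i j k : Fin n} (hik : i ≠ k) (hjk : j ≠ k) :
    ⁅pgen n r i, ⁅pgen n r i, pgen n r k⁆⁆ + r i • pgen n r k =
      ⁅pgen n r j, ⁅pgen n r j, pgen n r k⁆⁆ + r j • pgen n r k := by
  have h : LieSubmodule.Quotient.mk (N := gIdeal n r) _ = 0 :=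
    LieSubmodule.Quotient.mk_eq_zero'.mpr
      (LieSubmodule.subset_lieSpan (Or.inl ⟨i, j, k, hik, hjk, rfl⟩))
  have h' : ⁅pgen n r i, ⁅pgen n r i, pgen n r k⁆⁆ - ⁅pgen n r j, ⁅pgen n r j, pgen n r k⁆⁆
      - (r j - r i) • pgen n r k = 0 := h
  linear_combination (norm := module) h'

theorem pgen_rel_distinct {n : ℕ} {r : Fin n → ℂ} {i j k : Fin n} (hij : i ≠ j) (hik : i ≠ k)
    (hjk : j ≠ k) : ⁅pgen n r i, ⁅pgen n r j, pgen n r k⁆⁆ = 0 := by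
  have h : LieSubmodule.Quotient.mk (N := gIdeal n r) _ = 0 :=
    LieSubmodule.Quotient.mk_eq_zero'.mpr
      (LieSubmodule.subset_lieSpan (Or.inr ⟨i, j, k, hij, hik, hjk, rfl⟩))
  exact h

theorem Fin.exists_ne_and_ne {n : ℕ} (hn : 3 ≤ n) (i j : Fin n) : ∃ k, i ≠ k ∧ j ≠ k := by
  obtain ⟨k, hk⟩ := Finset.exists_mem_notMem_of_card_lt_card (s := {i, j}) (t := Finset.univ)
    (by simpa using Finset.card_le_two.trans_lt hn)
  simp only [Finset.mem_univ, Finset.mem_insert, Finset.mem_singleton, not_or, true_and] at hk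
  exact ⟨k, Ne.symm hk.1, Ne.symm hk.2⟩


theorem stmt_12 (n : ℕ) (hn : 3 ≤ n) (r : Fin n → ℂ) (hr : Function.Injective r)
    (gfil : ℕ → Submodule ℂ (gLL n r))
    (h0 : gfil 0 = ⊥)
    (h1 : gfil 1 = Submodule.span ℂ (Set.range (pgen n r)))
    (hm : ∀ m : ℕ, 2 ≤ m → gfil m =
      gfil 1 ⊔ Submodule.span ℂ
        {z | ∃ (i j : ℕ) (x y : gLL n r),
              i + j ≤ m ∧ x ∈ gfil i ∧ y ∈ gfil j ∧ z = ⁅x, y⁆}) :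
    ∀ m : ℕ, 1 ≤ m →
      (m % 2 = 1 →
        Module.rank ℂ (↥(gfil m) ⧸ (gfil (m-1)).comap (gfil m).subtype) ≤ (n : Cardinal)) ∧
      (m % 2 = 0 →
        Module.rank ℂ (↥(gfil m) ⧸ (gfil (m-1)).comap (gfil m).subtype) ≤ ((n * (n-1) / 2 : ℕ) : Cardinal)) := by
  have hι := Fin.exists_ne_and_ne hn
  choose s hs _ using fun i : Fin n => hι i i
  have hT := isTower_oddTower (r := r) (p := pgen n r) hs
    (fun _ _ _ hik hjk => pgen_rel_sq hik hjk)
    (fun _ _ _ hij hik hjk => pgen_rel_distinct hij hik hjk)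
  have hE := fun k => (hT.tables hι k).1
  have hO := fun k => (hT.tables hι k).2
  have hfil := hT.filtration_eq_towerSpan hE hO h0 h1 hm
  intro m hm1
  rw [hfil m, hfil (m - 1)]
  refine ⟨fun hodd => ?_, fun heven => ?_⟩
  · obtain ⟨k, rfl⟩ : ∃ k, m = 2 * k + 1 := ⟨m / 2, by omega⟩
    refine (rank_quotient_comap_sup_span_le _ (towerSpan_odd k)).trans_eq ?_
    rw [Fintype.card_fin]
  · obtain ⟨k, rfl⟩ : ∃ k, m = 2 * k + 2 := ⟨m / 2 - 1, by omega⟩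
    refine (rank_quotient_comap_sup_span_le _ (towerSpan_even (hE k))).trans_eq ?_
    rw [Fintype.card_sigma]
    simp only [Fintype.card_fin]
    rw [Fin.sum_univ_eq_sum_range (fun i => i), Finset.sum_range_id]
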